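/- arXiv:2009.11397 — 4 statements merged into one kernel-verified Lean document; each statement's English description precedes it below -/
import Mathlib

section
/- Let D and (D_k)_{k∈ℕ} be real-valued random variables (possibly on different probability spaces) such that D ≥ 0 almost surely, P(D = 0) = 0, and the laws of the D_k converge weakly to the Dirac measure δ_0 as k → ∞. Then AUROC(D_k, D) = ∫_ℝ F_{D_k}(τ) d(D_*P)(τ) → 1 as k → ∞. -/
open MeasureTheory Filter Topology

/-- If the laws of `X k` converge weakly to `δ_0`, then their distribution functions converge
to `1` at every positive point. -/
theorem tendsto_cdf_one_of_weak_conv_zero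
    {Ω : ℕ → Type*} [∀ k, MeasurableSpace (Ω k)]
    (Q : ∀ k, Measure (Ω k)) [∀ k, IsProbabilityMeasure (Q k)]
    (X : ∀ k, Ω k → ℝ) (hX : ∀ k, Measurable (X k))
    (hweak : ∀ h : BoundedContinuousFunction ℝ ℝ,
      Tendsto (fun k => ∫ ω, h (X k ω) ∂(Q k)) atTop (𝓝 (h 0)))
    {τ : ℝ} (hτ : 0 < τ) :
    Tendsto (fun k => (Q k).real {ω | X k ω ≤ τ}) atTop (𝓝 1) := by
  have hnonneg : ∀ x : ℝ, 0 ≤ max 0 (1 - |x| / τ) := fun x => le_max_left _ _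
  have hle : ∀ x : ℝ, max 0 (1 - |x| / τ) ≤ 1 := fun x =>
    max_le zero_le_one (sub_le_self _ (by positivity))
  let h : BoundedContinuousFunction ℝ ℝ :=
    BoundedContinuousFunction.ofNormedAddCommGroup (fun x => max 0 (1 - |x| / τ))
      (by fun_prop) 1 fun x => by
        rw [Real.norm_of_nonneg (hnonneg x)]
        exact hle x
  have hlim := hweak h
  have h_zero : h 0 = 1 := by simp [h]
  rw [h_zero] at hlim
  refine tendsto_of_tendsto_of_tendsto_of_le_of_le hlim tendsto_const_nhds (fun k => ?_)
    fun k => measureReal_le_one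
  have hmeas : MeasurableSet {ω | X k ω ≤ τ} := hX k measurableSet_Iic
  change ∫ ω, h (X k ω) ∂(Q k) ≤ (Q k).real {ω | X k ω ≤ τ}
  rw [← integral_indicator_one hmeas]
  refine integral_mono_of_nonneg (ae_of_all _ fun ω => hnonneg _)
    ((integrable_const (1 : ℝ)).indicator hmeas) (ae_of_all _ fun ω => ?_)
  by_cases hω : X k ω ≤ τ
  · simp only [Set.indicator, Set.mem_ofPred_eq, hω, if_true]
    exact hle (X k ω)
  · have h1 : 1 ≤ |X k ω| / τ :=
      (one_le_div hτ).2 ((not_le.1 hω).le.trans (le_abs_self _))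
    simpa [Set.indicator, hω, h] using h1

/-- Let `D` and `(D_k)` be real-valued random variables (possibly on
different probability spaces) such that `D ≥ 0` a.s., `P(D = 0) = 0`, and the laws of
the `D_k` converge weakly to the Dirac measure `δ_0` (tested against bounded continuous
functions). Then `AUROC(D_k, D) = ∫ F_{D_k}(τ) d(D_*P)(τ) → 1` as `k → ∞`. -/
theorem auroc_tendsto_one_of_weak_conv
    {Ω : Type*} [MeasurableSpace Ω] (P : Measure Ω) [IsProbabilityMeasure P]
    (D : Ω → ℝ) (hD : Measurable D)
    {Ω' : ℕ → Type*} [∀ k, MeasurableSpace (Ω' k)]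
    (Q : ∀ k, Measure (Ω' k)) [∀ k, IsProbabilityMeasure (Q k)]
    (Dk : ∀ k, Ω' k → ℝ) (hDk : ∀ k, Measurable (Dk k))
    (hpos : ∀ᵐ ω ∂P, 0 ≤ D ω)
    (hzero : P {ω | D ω = 0} = 0)
    (hweak : ∀ h : BoundedContinuousFunction ℝ ℝ,
      Tendsto (fun k => ∫ ω, h (Dk k ω) ∂(Q k)) atTop (𝓝 (h 0))) :
    Tendsto (fun k => ∫ τ, ((Q k) {ω | Dk k ω ≤ τ}).toReal ∂(P.map D))
      atTop (𝓝 1) := by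
  have : IsProbabilityMeasure (P.map D) := Measure.isProbabilityMeasure_map hD.aemeasurable
  have hlim : ∀ᵐ τ ∂(P.map D),
      Tendsto (fun k => ((Q k) {ω | Dk k ω ≤ τ}).toReal) atTop (𝓝 1) := by
    have hne : ∀ᵐ ω ∂P, D ω ≠ 0 := by simpa [ae_iff] using hzero
    have hτ : ∀ᵐ τ ∂(P.map D), 0 < τ := by
      rw [ae_map_iff hD.aemeasurable measurableSet_Ioi]
      filter_upwards [hpos, hne] with ω h1 h2 using lt_of_le_of_ne h1 h2.symm
    filter_upwards [hτ] with τ h using tendsto_cdf_one_of_weak_conv_zero Q Dk hDk hweak h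
  have key := tendsto_integral_of_dominated_convergence (μ := P.map D) (fun _ => (1 : ℝ))
    (fun k => ?_) (integrable_const _) (fun k => ae_of_all _ fun τ => ?_) hlim
  · simpa using key
  · have hmono : Monotone fun τ : ℝ => ((Q k) {ω | Dk k ω ≤ τ}).toReal := fun a b hab =>
      measureReal_mono fun ω (hω : Dk k ω ≤ a) => hω.trans hab
    exact hmono.measurable.aestronglyMeasurable
  · rw [Real.norm_of_nonneg ENNReal.toReal_nonneg]
    exact measureReal_le_one
end

section
/- Let D be a real-valued random variable with D ≥ 0 almost surely and P(D = 0) = 0, and let (D_k)_{k∈ℕ} be real-valued random variables on a probability space with D_k ≥ 0 almost surely for every k and D_k → 0 almost surely as k → ∞. Then AUROC(D_k, D) = ∫_ℝ F_{D_k}(τ) d(D_*P)(τ) → 1 as k → ∞. -/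
open MeasureTheory Filter Topology

/-- Let `D` be a real-valued random variable with `D ≥ 0` a.s. and
`P(D = 0) = 0`, and let `(D_k)` be real-valued random variables on a probability space
with `D_k ≥ 0` a.s. for every `k` and `D_k → 0` a.s. as `k → ∞`. Then
`AUROC(D_k, D) = ∫ F_{D_k}(τ) d(D_*P)(τ) → 1` as `k → ∞`. -/
theorem auroc_tendsto_one_of_ae_tendsto
    {Ω : Type*} [MeasurableSpace Ω] (P : Measure Ω) [IsProbabilityMeasure P]
    (D : Ω → ℝ) (hD : Measurable D)
    {Ω' : Type*} [MeasurableSpace Ω'] (Q : Measure Ω') [IsProbabilityMeasure Q]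
    (Dk : ℕ → Ω' → ℝ) (hDk : ∀ k, Measurable (Dk k))
    (hpos : ∀ᵐ ω ∂P, 0 ≤ D ω)
    (hzero : P {ω | D ω = 0} = 0)
    (hkpos : ∀ k, ∀ᵐ ω ∂Q, 0 ≤ Dk k ω)
    (hconv : ∀ᵐ ω ∂Q, Tendsto (fun k => Dk k ω) atTop (𝓝 0)) :
    Tendsto (fun k => ∫ τ, (Q {ω | Dk k ω ≤ τ}).toReal ∂(P.map D))
      atTop (𝓝 1) := by
  have h_ae : ∀ᵐ τ ∂(P.map D), 0 < τ := by
    rw [ae_map_iff hD.aemeasurable measurableSet_Ioi]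
    have hne : ∀ᵐ ω ∂P, D ω ≠ 0 := by simpa [ae_iff] using hzero
    filter_upwards [hpos, hne] with ω h h' using lt_of_le_of_ne h h'.symm
  have : IsProbabilityMeasure (P.map D) := Measure.isProbabilityMeasure_map hD.aemeasurable
  have h_one : ∫ _, (1 : ℝ) ∂(P.map D) = 1 := by simp
  rw [← h_one]
  refine tendsto_integral_of_dominated_convergence (fun _ => 1) (fun k => ?_)
    (integrable_const 1) (fun k => ae_of_all _ fun τ => ?_) ?_
  · refine Measurable.aestronglyMeasurable (Monotone.measurable fun s t hst => ?_)
    exact ENNReal.toReal_mono (measure_ne_top _ _)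
      (measure_mono fun ω (h : Dk k ω ≤ s) => h.trans hst)
  · rw [Real.norm_of_nonneg ENNReal.toReal_nonneg]
    exact ENNReal.toReal_le_of_le_ofReal zero_le_one (by simpa using prob_le_one)
  · filter_upwards [h_ae] with τ hτ
    have h_lim : Tendsto (fun k => Q {ω | Dk k ω ≤ τ}) atTop (𝓝 (Q Set.univ)) := by
      refine tendsto_measure_of_ae_tendsto_indicator_of_isFiniteMeasure atTop
        MeasurableSet.univ (fun k => measurableSet_le (hDk k) measurable_const) ?_
      filter_upwards [hconv] with ω hω
      filter_upwards [hω.eventually_le_const hτ] with k hk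
      simpa using hk
    simpa [Function.comp_def] using (ENNReal.tendsto_toReal (measure_ne_top _ _)).comp h_lim
end

section
/- Let E be a real inner product space, let ε > 0, b > 0, and let x, x_k, x*, g ∈ E satisfy ‖x_k − x*‖ ≤ ε, 2ε ≤ ‖x − x*‖ ≤ 3ε, and ⟨g, x − x*⟩ > 0. Then the vector G = 2(x − x_k) + b·g satisfies ⟨G, x − x*⟩ > 2ε²/3. -/
open scoped RealInnerProductSpace

/-- Let `E` be a real inner product space, `ε > 0`, `b > 0`, and let
`x, x_k, x*, g ∈ E` satisfy `‖x_k − x*‖ ≤ ε`, `2ε ≤ ‖x − x*‖ ≤ 3ε`, and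
`⟨g, x − x*⟩ > 0`. Then `G = 2(x − x_k) + b·g` satisfies `⟨G, x − x*⟩ > 2ε²/3`. -/
theorem gradient_inner_gt
    {E : Type*} [NormedAddCommGroup E] [InnerProductSpace ℝ E]
    {ε b : ℝ} (hε : 0 < ε) (hb : 0 < b) {x xk xs g : E}
    (hxk : ‖xk - xs‖ ≤ ε) (hx₁ : 2 * ε ≤ ‖x - xs‖) (hx₂ : ‖x - xs‖ ≤ 3 * ε)
    (hg : 0 < ⟪g, x - xs⟫) :
    2 * ε ^ 2 / 3 < ⟪(2 : ℝ) • (x - xk) + b • g, x - xs⟫ := by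
  have hsplit : x - xk = (x - xs) - (xk - xs) := by abel
  have hcs : ⟪xk - xs, x - xs⟫ ≤ ε * ‖x - xs‖ :=
    (real_inner_le_norm _ _).trans (by gcongr)
  rw [inner_add_left, real_inner_smul_left, real_inner_smul_left, hsplit, inner_sub_left,
    real_inner_self_eq_norm_sq]
  have hbg : 0 < b * ⟪g, x - xs⟫ := mul_pos hb hg
  have hr : 2 * ε * ε ≤ ‖x - xs‖ * (‖x - xs‖ - ε) :=
    mul_le_mul hx₁ (by linarith) hε.le (norm_nonneg _)
  nlinarith [sq_nonneg ε]
end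

section
/- Let E be a real inner product space, x* ∈ E, ε > 0, K ≥ 1, and let G : E → E satisfy: (i) ‖G(x)‖ ≤ 8εK for every x with ‖x − x*‖ ≤ 3ε, and (ii) ⟨G(x), x − x*⟩ ≥ 2ε²/3 for every x with 2ε ≤ ‖x − x*‖ ≤ 3ε. Let (α_j)_{j∈ℕ} be step sizes with 0 < α_j ≤ min(1/(48K²), 1/(8K)) for all j, and define a sequence by x_0 ∈ E with ‖x_0 − x*‖ ≤ ε and x_{j+1} = x_j − α_j·G(x_j). Then ‖x_j − x*‖ ≤ 3ε for every j ∈ ℕ, i.e., the iteration never leaves the closed ball of radius 3ε around x*. -/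
open scoped RealInnerProductSpace

/-- Let `E` be a real inner product space, `x* ∈ E`, `ε > 0`, `K ≥ 1`,
and let `G : E → E` satisfy (i) `‖G(x)‖ ≤ 8εK` whenever `‖x − x*‖ ≤ 3ε`, and
(ii) `⟨G(x), x − x*⟩ ≥ 2ε²/3` whenever `2ε ≤ ‖x − x*‖ ≤ 3ε`. Let `(α_j)` be step sizes
with `0 < α_j ≤ min(1/(48K²), 1/(8K))`, and define a sequence by `x_0` with
`‖x_0 − x*‖ ≤ ε` and `x_{j+1} = x_j − α_j·G(x_j)`. Then `‖x_j − x*‖ ≤ 3ε` for all `j`,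
i.e., the iteration never leaves the closed ball of radius `3ε` around `x*`. -/
theorem iteration_stays_in_ball
    {E : Type*} [NormedAddCommGroup E] [InnerProductSpace ℝ E]
    (xs : E) {ε K : ℝ} (hε : 0 < ε) (hK : 1 ≤ K) (G : E → E)
    (hGnorm : ∀ x : E, ‖x - xs‖ ≤ 3 * ε → ‖G x‖ ≤ 8 * ε * K)
    (hGinner : ∀ x : E, 2 * ε ≤ ‖x - xs‖ → ‖x - xs‖ ≤ 3 * ε →
      2 * ε ^ 2 / 3 ≤ ⟪G x, x - xs⟫)
    (α : ℕ → ℝ) (hα₀ : ∀ j, 0 < α j)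
    (hα₁ : ∀ j, α j ≤ min (1 / (48 * K ^ 2)) (1 / (8 * K)))
    (x : ℕ → E) (hx0 : ‖x 0 - xs‖ ≤ ε)
    (hstep : ∀ j, x (j + 1) = x j - α j • G (x j)) :
    ∀ j, ‖x j - xs‖ ≤ 3 * ε := by
  have hK0 : 0 < K := by linarith
  intro j
  induction j with
  | zero => linarith
  | succ j ih =>
    have hG := hGnorm (x j) ih
    have hα := hα₀ j
    obtain ⟨h48, h8⟩ := le_min_iff.mp (hα₁ j)
    rw [le_div_iff₀ (by positivity)] at h48 h8
    have hsub : x (j + 1) - xs = (x j - xs) - α j • G (x j) := by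
      rw [hstep]; abel
    have hnorm : ‖α j • G (x j)‖ = α j * ‖G (x j)‖ := by
      rw [norm_smul, Real.norm_of_nonneg hα.le]
    rw [hsub]
    rcases le_total (2 * ε) ‖x j - xs‖ with hfar | hnear
    · have hinner := hGinner (x j) hfar ih
      have hexp : ‖(x j - xs) - α j • G (x j)‖ ^ 2 =
          ‖x j - xs‖ ^ 2 - 2 * (α j * ⟪G (x j), x j - xs⟫) + (α j * ‖G (x j)‖) ^ 2 := by
        rw [norm_sub_sq_real, hnorm, real_inner_smul_right, real_inner_comm]
      have hdrift : α j * (2 * ε ^ 2 / 3) ≤ α j * ⟪G (x j), x j - xs⟫ :=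
        mul_le_mul_of_nonneg_left hinner hα.le
      have hquad : (α j * ‖G (x j)‖) ^ 2 ≤ (α j * (8 * ε * K)) ^ 2 := by gcongr
      have hsmall : α j * ε ^ 2 * (α j * (48 * K ^ 2)) ≤ α j * ε ^ 2 * 1 :=
        mul_le_mul_of_nonneg_left h48 (by positivity)
      refine le_trans ((sq_le_sq₀ (norm_nonneg _) (norm_nonneg _)).mp ?_) ih
      linarith
    · have hmove : α j * ‖G (x j)‖ ≤ α j * (8 * ε * K) :=
        mul_le_mul_of_nonneg_left hG hα.le
      have hε' : ε * (α j * (8 * K)) ≤ ε * 1 := mul_le_mul_of_nonneg_left h8 hε.le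
      have htri := norm_sub_le (x j - xs) (α j • G (x j))
      rw [hnorm] at htri
      linarith
end
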